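/- If N ≥ 2 and N' ≥ 4, then for every integer K ≥ 1, P(𝔭(u_1) = 𝔭(u_2) ≠ 𝔭(u_3) = 𝔭(u_4), ν_{𝔭(u_1)} ≤ K, and ν_{𝔭(u_3)} ≤ K) = ((N)_2 / (N')_4) · E[(ν_1)_2 (ν_2)_2 · 1{ν_1 ≤ K and ν_2 ≤ K}]. -/

import Mathlib

open MeasureTheory Finset
open scoped ENNReal

/-- The parent map associated with an offspring vector `v`. -/
noncomputable def parentMap (v : ℕ → ℕ) (c : ℕ) : ℕ :=
  sInf {i : ℕ | c < ∑ j ∈ Finset.range (i + 1), v j}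

/-- The value of a permutation of `Fin M` at position `i < M`, and `0` otherwise. -/
def permVal {M : ℕ} (e : Equiv.Perm (Fin M)) (i : ℕ) : ℕ :=
  if h : i < M then (e ⟨i, h⟩ : Fin M) else 0

lemma exists_perm_ext {α : Type*} [Finite α] {β : Type*} (ι x : β ↪ α) :
    ∃ g : Equiv.Perm α, ∀ b, g (ι b) = x b := by
  classical
  cases nonempty_fintype α
  let e : {a // a ∈ Set.range ι} ≃ {a // a ∈ Set.range x} :=
    (Equiv.ofInjective ι ι.injective).symm.trans (Equiv.ofInjective x x.injective)
  refine ⟨e.extendSubtype, fun b => ?_⟩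
  rw [Equiv.extendSubtype_apply_of_mem _ _ ⟨b, rfl⟩]
  simp [e]

lemma perm_avg {M : ℕ} (ι : Fin 4 ↪ Fin M) (f : (Fin 4 ↪ Fin M) → ℕ) :
    M.descFactorial 4 * ∑ e : Equiv.Perm (Fin M), f (ι.trans e.toEmbedding)
      = M.factorial * ∑ x, f x := by
  have h1 : ∀ x : Fin 4 ↪ Fin M, ∑ e : Equiv.Perm (Fin M), f (x.trans e.toEmbedding)
      = ∑ e : Equiv.Perm (Fin M), f (ι.trans e.toEmbedding) := by
    intro x
    obtain ⟨g, hg⟩ := exists_perm_ext ι x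
    rw [← Equiv.sum_comp (Equiv.mulRight g)
      (fun e : Equiv.Perm (Fin M) => f (ι.trans e.toEmbedding))]
    refine Finset.sum_congr rfl fun e _ => ?_
    congr 1
    ext b
    simp [hg]
  have h2 : ∀ e : Equiv.Perm (Fin M), ∑ x : Fin 4 ↪ Fin M, f (x.trans e.toEmbedding)
      = ∑ x, f x := by
    intro e
    exact Equiv.sum_comp (Equiv.embeddingCongr (Equiv.refl (Fin 4)) e) f
  have h3 := Finset.sum_comm (s := (univ : Finset (Fin 4 ↪ Fin M)))
    (t := (univ : Finset (Equiv.Perm (Fin M)))) (f := fun x e => f (x.trans e.toEmbedding))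
  simp only [h1, h2] at h3
  simpa [Fintype.card_perm, Fintype.card_embedding_eq] using h3

lemma parentMap_eq_iff {v : ℕ → ℕ} {N M c : ℕ} (h : ∑ j ∈ range N, v j = M) (hc : c < M) (i : ℕ) :
    parentMap v c = i ↔ ∑ j ∈ range i, v j ≤ c ∧ c < ∑ j ∈ range (i+1), v j := by
  have hmono : Monotone fun n => ∑ j ∈ range n, v j := fun a b hab =>
    Finset.sum_le_sum_of_subset (by simpa using hab)
  have hne : {i : ℕ | c < ∑ j ∈ range (i + 1), v j}.Nonempty :=
    ⟨N, lt_of_lt_of_le (by simpa [h] using hc) (hmono (Nat.le_succ N))⟩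
  have hmem := Nat.sInf_mem hne
  have hlow : ∑ j ∈ range (parentMap v c), v j ≤ c := by
    rcases Nat.eq_zero_or_pos (parentMap v c) with h0 | h0
    · simp [h0]
    · have := Nat.notMem_of_lt_sInf (s := {i : ℕ | c < ∑ j ∈ range (i + 1), v j})
        (m := parentMap v c - 1) (by unfold parentMap at *; omega)
      simp only [Set.mem_ofPred_eq, not_lt] at this
      rwa [Nat.sub_add_cancel h0] at this
  constructor
  · rintro rfl
    exact ⟨hlow, hmem⟩
  · rintro ⟨h1, h2⟩
    apply le_antisymm
    · exact Nat.sInf_le h2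
    · by_contra hlt
      push Not at hlt
      have := hmono (show parentMap v c + 1 ≤ i from hlt)
      have h3 : c < ∑ j ∈ range (parentMap v c + 1), v j := hmem
      simp only at this
      omega

lemma parentMap_lt {v : ℕ → ℕ} {N M c : ℕ} (h : ∑ j ∈ range N, v j = M) (hc : c < M) :
    parentMap v c < N := by
  have h1 := ((parentMap_eq_iff h hc _).1 rfl).1
  by_contra hlt
  push Not at hlt
  have : ∑ j ∈ range N, v j ≤ ∑ j ∈ range (parentMap v c), v j :=
    Finset.sum_le_sum_of_subset (by simpa using hlt)
  omega

lemma parentMap_fiber {v : ℕ → ℕ} {N M : ℕ} (h : ∑ j ∈ range N, v j = M) (i : ℕ) (hi : i < N) :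
    (univ.filter fun c : Fin M => parentMap v c = i).card = v i := by
  have : ∑ j ∈ range (i+1), v j ≤ M := by
    rw [← h]
    exact Finset.sum_le_sum_of_subset (by simpa using hi)
  rw [← Finset.card_map Fin.valEmbedding]
  have h2 : (univ.filter fun c : Fin M => parentMap v c = i).map Fin.valEmbedding
      = Finset.Ico (∑ j ∈ range i, v j) (∑ j ∈ range (i+1), v j) := by
    ext c
    simp only [mem_map, mem_filter, mem_univ, true_and, Fin.valEmbedding_apply, mem_Ico]
    constructor
    · rintro ⟨a, ha, rfl⟩
      exact (parentMap_eq_iff h a.2 i).1 ha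
    · rintro hc
      exact ⟨⟨c, by omega⟩, (parentMap_eq_iff h (by omega) i).2 hc, rfl⟩
  rw [h2, Nat.card_Ico, Finset.sum_range_succ]
  omega

lemma offDiag_card' {α : Type*} [DecidableEq α] (s : Finset α) :
    s.offDiag.card = s.card.descFactorial 2 := by
  rw [Finset.offDiag_card]
  simp [Nat.descFactorial, Nat.sub_mul]

/-- weight -/
def gwt (K a b : ℕ) : ℕ :=
  a.descFactorial 2 * b.descFactorial 2 * (if a ≤ K ∧ b ≤ K then 1 else 0)

lemma count_emb {N M : ℕ} (p : Fin M → Fin N) (w : Fin N → ℕ) (K : ℕ)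
    (hp : ∀ i, (univ.filter fun c => p c = i).card = w i) :
    ∑ x : Fin 4 ↪ Fin M, (if p (x 0) = p (x 1) ∧ p (x 2) = p (x 3) ∧ p (x 0) ≠ p (x 2)
        ∧ w (p (x 0)) ≤ K ∧ w (p (x 2)) ≤ K then 1 else 0)
      = ∑ q ∈ (univ : Finset (Fin N)).offDiag, gwt K (w q.1) (w q.2) := by
  classical
  rw [← Finset.card_filter]
  rw [Finset.card_eq_sum_card_fiberwise (f := fun x : Fin 4 ↪ Fin M => (p (x 0), p (x 2)))
    (t := (univ : Finset (Fin N)).offDiag) (by intro x hx; simp at hx ⊢; exact hx.2.2.1)]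
  refine Finset.sum_congr rfl ?_
  rintro ⟨i, j⟩ hij
  have hij : i ≠ j := by simpa using hij
  unfold gwt
  simp only
  split_ifs with hK
  · rw [mul_one, ← hp i, ← hp j, ← offDiag_card', ← offDiag_card', ← Finset.card_product]
    refine Finset.card_bij (fun x _ => ((x 0, x 1), (x 2, x 3))) ?_ ?_ ?_
    · intro x hx
      simp only [mem_filter, mem_univ, true_and, Prod.mk.injEq] at hx
      simp only [mem_product, mem_offDiag, mem_filter, mem_univ, true_and]
      obtain ⟨⟨h1, h2, h3, h4, h5⟩, h6, h7⟩ := hx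
      refine ⟨⟨h6, h1 ▸ h6, ?_⟩, h7, h2 ▸ h7, ?_⟩
      · exact fun h => absurd (x.injective h) (by decide)
      · exact fun h => absurd (x.injective h) (by decide)
    · intro x _ y _ h
      simp only [Prod.mk.injEq] at h
      obtain ⟨⟨h0, h1⟩, h2, h3⟩ := h
      ext k
      fin_cases k <;> simp [h0, h1, h2, h3]
    · rintro ⟨⟨a, b⟩, ⟨c, d⟩⟩ h
      simp only [mem_product, mem_offDiag, mem_filter, mem_univ, true_and] at h
      obtain ⟨⟨ha, hb, hab⟩, hc, hd, hcd⟩ := h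
      have hac : a ≠ c := by rintro rfl; exact hij (ha.symm.trans hc)
      have had : a ≠ d := by rintro rfl; exact hij (ha.symm.trans hd)
      have hbc : b ≠ c := by rintro rfl; exact hij (hb.symm.trans hc)
      have hbd : b ≠ d := by rintro rfl; exact hij (hb.symm.trans hd)
      refine ⟨⟨![a, b, c, d], ?_⟩, ?_, ?_⟩
      · intro k l hkl
        fin_cases k <;> fin_cases l <;> simp_all
      · simp only [mem_filter, mem_univ, true_and, Prod.mk.injEq]
        change (p a = p b ∧ p c = p d ∧ p a ≠ p c ∧ w (p a) ≤ K ∧ w (p c) ≤ K) ∧ p a = i ∧ p c = j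
        simp [ha, hb, hc, hd, hij, hK]
      · rfl
  · rw [mul_zero, Finset.card_eq_zero, Finset.filter_eq_empty_iff]
    intro x hx h
    simp only [mem_filter, mem_univ, true_and, Prod.mk.injEq] at hx h
    obtain ⟨rfl, rfl⟩ := h
    exact hK hx.2.2.2

lemma measurable_parentMap (c : ℕ) : Measurable fun v : ℕ → ℕ => parentMap v c := by
  have hs : ∀ j : ℕ, MeasurableSet {v : ℕ → ℕ | c < ∑ k ∈ range (j + 1), v k} := fun j =>
    measurableSet_lt measurable_const
      (Finset.measurable_sum _ fun k _ => measurable_pi_apply k)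
  refine measurable_to_countable' fun i => ?_
  have : (fun v : ℕ → ℕ => parentMap v c) ⁻¹' {i}
      = {v | (c < ∑ k ∈ range (i + 1), v k ∧ ∀ j, j < i → ¬ c < ∑ k ∈ range (j + 1), v k)
        ∨ (i = 0 ∧ ∀ j, ¬ c < ∑ k ∈ range (j + 1), v k)} := by
    ext v
    simp only [Set.mem_preimage, Set.mem_singleton_iff, Set.mem_ofPred_eq]
    constructor
    · rintro rfl
      by_cases hne : {i : ℕ | c < ∑ j ∈ range (i + 1), v j}.Nonempty
      · left
        exact ⟨Nat.sInf_mem hne, fun j hj =>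
          Nat.notMem_of_lt_sInf (s := {i : ℕ | c < ∑ j ∈ range (i + 1), v j}) hj⟩
      · right
        rw [Set.not_nonempty_iff_eq_empty] at hne
        refine ⟨by unfold parentMap; rw [hne]; simp, fun j hj => ?_⟩
        have : j ∈ {i : ℕ | c < ∑ j ∈ range (i + 1), v j} := hj
        rw [hne] at this
        exact this
    · rintro (⟨h1, h2⟩ | ⟨rfl, h⟩)
      · apply le_antisymm
          (Nat.sInf_le (s := {i : ℕ | c < ∑ j ∈ range (i + 1), v j}) h1)
        by_contra hlt
        push Not at hlt
        exact h2 _ hlt (Nat.sInf_mem (s := {i : ℕ | c < ∑ j ∈ range (i + 1), v j}) ⟨i, h1⟩)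
      · unfold parentMap
        rw [Set.eq_empty_of_forall_notMem (s := {i : ℕ | c < ∑ j ∈ range (i + 1), v j}) h]
        simp
  rw [this]
  have m1 : MeasurableSet {v : ℕ → ℕ | ∀ j, j < i → ¬ c < ∑ k ∈ range (j + 1), v k} := ?_
  have m2 : MeasurableSet {v : ℕ → ℕ | ∀ j, ¬ c < ∑ k ∈ range (j + 1), v k} := ?_
  · exact MeasurableSet.union (MeasurableSet.inter (hs i) m1) (MeasurableSet.inter (.const _) m2)
  rotate_left
  · have := MeasurableSet.iInter fun j => MeasurableSet.iInter fun (_ : j < i) => (hs j).compl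
    convert this using 1
    ext v; simp
  · have := MeasurableSet.iInter fun j => (hs j).compl
    convert this using 1
    ext v; simp

lemma measurable_val_parentMap (c : ℕ) : Measurable fun v : ℕ → ℕ => v (parentMap v c) := by
  have h : Measurable fun q : (ℕ → ℕ) × ℕ => q.1 q.2 :=
    measurable_from_prod_countable_left fun n => measurable_pi_apply n
  exact h.comp (measurable_id.prodMk (measurable_parentMap c))

/-- The event. -/
def evt {M : ℕ} (K : ℕ) (e : Equiv.Perm (Fin M)) : Set (ℕ → ℕ) :=
  {v | parentMap v (permVal e 0) = parentMap v (permVal e 1)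
          ∧ parentMap v (permVal e 2) = parentMap v (permVal e 3)
          ∧ parentMap v (permVal e 0) ≠ parentMap v (permVal e 2)
          ∧ v (parentMap v (permVal e 0)) ≤ K
          ∧ v (parentMap v (permVal e 2)) ≤ K}

lemma measurableSet_evt {M : ℕ} (K : ℕ) (e : Equiv.Perm (Fin M)) : MeasurableSet (evt K e) := by
  refine (measurableSet_eq_fun (measurable_parentMap _) (measurable_parentMap _)).inter
    ((measurableSet_eq_fun (measurable_parentMap _) (measurable_parentMap _)).inter
    ((measurableSet_eq_fun (measurable_parentMap _) (measurable_parentMap _)).compl.inter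
    ((measurableSet_le (measurable_val_parentMap _) measurable_const).inter
    (measurableSet_le (measurable_val_parentMap _) measurable_const))))

open Classical in
lemma count_perm {N M : ℕ} (hM : 4 ≤ M) (K : ℕ) (v : ℕ → ℕ) (h : ∑ j ∈ range N, v j = M) :
    M.descFactorial 4 * ∑ e : Equiv.Perm (Fin M), (if v ∈ evt K e then 1 else 0)
      = M.factorial * ∑ q ∈ (univ : Finset (Fin N)).offDiag, gwt K (v q.1) (v q.2) := by
  let p : Fin M → Fin N := fun c => ⟨parentMap v c, parentMap_lt h c.2⟩
  have hp : ∀ i, (univ.filter fun c => p c = i).card = v i := by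
    intro i
    rw [← parentMap_fiber h i i.2]
    simp [p, Fin.ext_iff]
  rw [← count_emb p (fun i => v i) K hp, ← perm_avg (Fin.castLEEmb hM)]
  congr 1
  refine Finset.sum_congr rfl fun e _ => ?_
  have h0 : permVal e 0 = e (Fin.castLE hM 0) := by
    unfold permVal; rw [dif_pos (by omega)]; rfl
  have h1 : permVal e 1 = e (Fin.castLE hM 1) := by
    unfold permVal; rw [dif_pos (by omega)]; rfl
  have h2 : permVal e 2 = e (Fin.castLE hM 2) := by
    unfold permVal; rw [dif_pos (by omega)]; rfl
  have h3 : permVal e 3 = e (Fin.castLE hM 3) := by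
    unfold permVal; rw [dif_pos (by omega)]; rfl
  simp only [evt, Set.mem_ofPred_eq, h0, h1, h2, h3, p, Fin.ext_iff, ne_eq]
  rfl

set_option maxHeartbeats 1000000 in
/-- If `N ≥ 2` and `N' ≥ 4`, then for every `K ≥ 1`,
`P(𝔭(u_1) = 𝔭(u_2) ≠ 𝔭(u_3) = 𝔭(u_4), ν_{𝔭(u_1)} ≤ K, ν_{𝔭(u_3)} ≤ K)
  = ((N)_2 / (N')_4) · E[(ν_1)_2 (ν_2)_2 · 1{ν_1 ≤ K ∧ ν_2 ≤ K}]`.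
(Indices of `u` and `ν` are shifted to be `0`-based.) -/
theorem coalescent_truncated_two_pairs_probability
    {Ω : Type*} [MeasurableSpace Ω] (P : Measure Ω) [IsProbabilityMeasure P]
    (N N' : ℕ) (hN : 2 ≤ N) (hN' : 4 ≤ N')
    (ν : Ω → ℕ → ℕ) (hνmeas : Measurable ν)
    (hsum : ∀ᵐ ω ∂P, ∑ i ∈ Finset.range N, ν ω i = N')
    (hexch : ∀ π : Equiv.Perm (Fin N),
      Measure.map (fun ω => fun i : Fin N => ν ω (π i)) P
        = Measure.map (fun ω => fun i : Fin N => ν ω i) P)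
    (σ : Ω → Equiv.Perm (Fin N'))
    (hσmeas : ∀ e, MeasurableSet {ω | σ ω = e})
    (hσunif : ∀ e : Equiv.Perm (Fin N'),
      P {ω | σ ω = e} = 1 / (Nat.factorial N' : ℝ≥0∞))
    (hindep : ∀ (e : Equiv.Perm (Fin N')) (S : Set (ℕ → ℕ)), MeasurableSet S →
      P ({ω | σ ω = e} ∩ ν ⁻¹' S) = P {ω | σ ω = e} * P (ν ⁻¹' S))
    (K : ℕ) (hK : 1 ≤ K) :
    (P {ω | parentMap (ν ω) (permVal (σ ω) 0) = parentMap (ν ω) (permVal (σ ω) 1)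
          ∧ parentMap (ν ω) (permVal (σ ω) 2) = parentMap (ν ω) (permVal (σ ω) 3)
          ∧ parentMap (ν ω) (permVal (σ ω) 0) ≠ parentMap (ν ω) (permVal (σ ω) 2)
          ∧ ν ω (parentMap (ν ω) (permVal (σ ω) 0)) ≤ K
          ∧ ν ω (parentMap (ν ω) (permVal (σ ω) 2)) ≤ K}).toReal
      = ((N.descFactorial 2 : ℝ) / (N'.descFactorial 4 : ℝ))
        * ∫ ω, ((ν ω 0).descFactorial 2 : ℝ) * ((ν ω 1).descFactorial 2 : ℝ)
            * (if ν ω 0 ≤ K ∧ ν ω 1 ≤ K then (1 : ℝ) else 0) ∂P := by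
  classical
  have hV : Measurable fun ω => fun i : Fin N => ν ω i :=
    measurable_pi_lambda _ fun i => measurable_pi_iff.1 hνmeas i
  set G : ℝ≥0∞ := ∫⁻ ω, (gwt K (ν ω 0) (ν ω 1) : ℝ≥0∞) ∂P with hG
  have hmeasG : ∀ i j : ℕ, Measurable fun ω => (gwt K (ν ω i) (ν ω j) : ℝ≥0∞) := by
    intro i j
    have h : Measurable fun q : ℕ × ℕ => (gwt K q.1 q.2 : ℝ≥0∞) := measurable_of_countable _
    have hi : Measurable fun ω => ν ω i := measurable_pi_iff.1 hνmeas i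
    have hj : Measurable fun ω => ν ω j := measurable_pi_iff.1 hνmeas j
    have h3 := h.comp (hi.prodMk hj)
    simp only [Function.comp_def] at h3
    exact h3
  -- exchangeability
  have hex : ∀ q ∈ (univ : Finset (Fin N)).offDiag,
      ∫⁻ ω, (gwt K (ν ω q.1) (ν ω q.2) : ℝ≥0∞) ∂P = G := by
    rintro ⟨i, j⟩ hij
    have hij : i ≠ j := by simpa using hij
    let x : Fin 2 ↪ Fin N := ⟨![i, j], by
      intro k l hkl
      fin_cases k <;> fin_cases l <;> simp_all⟩
    obtain ⟨π, hπ⟩ := exists_perm_ext (Fin.castLEEmb hN) x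
    have hπ0 : π ⟨0, by omega⟩ = i := hπ 0
    have hπ1 : π ⟨1, by omega⟩ = j := hπ 1
    let F : (Fin N → ℕ) → ℝ≥0∞ := fun w => (gwt K (w ⟨0, by omega⟩) (w ⟨1, by omega⟩) : ℝ≥0∞)
    have hF : Measurable F := measurable_of_countable _
    have hVπ : Measurable fun ω => fun i : Fin N => ν ω (π i) :=
      measurable_pi_lambda _ fun i => measurable_pi_iff.1 hνmeas (π i)
    have h1 := lintegral_map (μ := P) hF hVπ
    have h2 := lintegral_map (μ := P) hF hV
    rw [hexch π, h2] at h1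
    simp only [F, hπ0, hπ1] at h1
    exact h1.symm
  -- decomposition
  have hdec : P {ω | parentMap (ν ω) (permVal (σ ω) 0) = parentMap (ν ω) (permVal (σ ω) 1)
          ∧ parentMap (ν ω) (permVal (σ ω) 2) = parentMap (ν ω) (permVal (σ ω) 3)
          ∧ parentMap (ν ω) (permVal (σ ω) 0) ≠ parentMap (ν ω) (permVal (σ ω) 2)
          ∧ ν ω (parentMap (ν ω) (permVal (σ ω) 0)) ≤ K
          ∧ ν ω (parentMap (ν ω) (permVal (σ ω) 2)) ≤ K}
      = ∑ e : Equiv.Perm (Fin N'), P ({ω | σ ω = e} ∩ ν ⁻¹' (evt K e)) := by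
    rw [← tsum_fintype (L := .unconditional _), ← measure_iUnion]
    · congr 1
      ext ω
      simp [evt]
    · intro e e' hee
      refine Set.disjoint_left.2 ?_
      intro ω h1 h2
      have h1' : σ ω = e := (Set.mem_inter_iff _ _ _ |>.1 h1).1
      have h2' : σ ω = e' := (Set.mem_inter_iff _ _ _ |>.1 h2).1
      exact hee (h1'.symm.trans h2')
    · exact fun e => (hσmeas e).inter (hνmeas (measurableSet_evt K e))
  have hsumE : ∑ e : Equiv.Perm (Fin N'), P (ν ⁻¹' (evt K e))
      = ∫⁻ ω, ((∑ e : Equiv.Perm (Fin N'), (if ν ω ∈ evt K e then 1 else 0) : ℕ) : ℝ≥0∞) ∂P := by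
    push_cast
    rw [lintegral_finsetSum]
    · refine Finset.sum_congr rfl fun e _ => ?_
      rw [← lintegral_indicator_one (hνmeas (measurableSet_evt K e))]
      refine lintegral_congr fun ω => ?_
      simp [Set.indicator_apply]
    · intro e _
      exact Measurable.ite (hνmeas (measurableSet_evt K e)) measurable_const measurable_const
  have hkey : (N'.descFactorial 4 : ℝ≥0∞) * ∑ e : Equiv.Perm (Fin N'), P (ν ⁻¹' (evt K e))
      = (N'.factorial : ℝ≥0∞) * ((N.descFactorial 2 : ℝ≥0∞) * G) := by
    rw [hsumE, ← lintegral_const_mul']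
    · have : ∫⁻ ω, (N'.descFactorial 4 : ℝ≥0∞)
          * ((∑ e : Equiv.Perm (Fin N'), (if ν ω ∈ evt K e then 1 else 0) : ℕ) : ℝ≥0∞) ∂P
          = ∫⁻ ω, (N'.factorial : ℝ≥0∞) * ∑ q ∈ (univ : Finset (Fin N)).offDiag,
            (gwt K (ν ω q.1) (ν ω q.2) : ℝ≥0∞) ∂P := by
        refine lintegral_congr_ae ?_
        filter_upwards [hsum] with ω hω
        exact_mod_cast count_perm hN' K (ν ω) hω
      rw [this, lintegral_const_mul' _ _ (by simp), lintegral_finsetSum _ fun q _ => hmeasG _ _,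
        Finset.sum_congr rfl hex]
      rw [Finset.sum_const, offDiag_card', Finset.card_univ, Fintype.card_fin, nsmul_eq_mul]
    · exact ENNReal.natCast_ne_top _
  have hf0 : (N'.factorial : ℝ) ≠ 0 := by exact_mod_cast N'.factorial_ne_zero
  have hd0 : (N'.descFactorial 4 : ℝ) ≠ 0 := by
    exact Nat.cast_ne_zero.2 fun h => absurd (Nat.descFactorial_eq_zero_iff_lt.1 h) (by omega)
  have hint : ∫ ω, ((ν ω 0).descFactorial 2 : ℝ) * ((ν ω 1).descFactorial 2 : ℝ)
            * (if ν ω 0 ≤ K ∧ ν ω 1 ≤ K then (1 : ℝ) else 0) ∂P = G.toReal := by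
    rw [hG, ← integral_toReal (hmeasG 0 1).aemeasurable (by simp)]
    refine integral_congr_ae (Filter.Eventually.of_forall fun ω => ?_)
    simp only [ENNReal.toReal_natCast, gwt]
    rw [Nat.cast_mul, Nat.cast_mul, Nat.cast_ite, Nat.cast_one, Nat.cast_zero]
  have hreal := congrArg ENNReal.toReal hkey
  simp only [ENNReal.toReal_mul, ENNReal.toReal_natCast] at hreal
  rw [hint, hdec]
  simp_rw [fun e => hindep e (evt K e) (measurableSet_evt K e), hσunif]
  rw [← Finset.mul_sum, ENNReal.toReal_mul]
  simp only [one_div, ENNReal.toReal_inv, ENNReal.toReal_natCast]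
  field_simp
  linarith
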